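/- Let Ω = {(x,y) ∈ [0,1]² : x + y ≤ 1} be the triangle below the anti-diagonal. Then the expected squared L2-discrepancy of the two-point jittered sampling construction associated to Ω equals D(Ω) = 1/20 (= 0.05). -/

import Mathlib

open MeasureTheory Set

noncomputable section

/-- The closed unit square `[0,1]²` in `ℝ × ℝ`. -/
def unitSq : Set (ℝ × ℝ) := Icc (0:ℝ) 1 ×ˢ Icc (0:ℝ) 1

/-- The anchored axis-parallel box `[0,x] × [0,y]`. -/
def box (x y : ℝ) : Set (ℝ × ℝ) := Icc (0:ℝ) x ×ˢ Icc (0:ℝ) y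

/-- The uniform probability measure on a set `S ⊆ ℝ²`. -/
def unif (S : Set (ℝ × ℝ)) : Measure (ℝ × ℝ) := (volume S)⁻¹ • volume.restrict S

/-- The number of the two points `p1`, `p2` lying in the box `[0,x] × [0,y]`. -/
def countIn (p1 p2 : ℝ × ℝ) (x y : ℝ) : ℝ :=
  (box x y).indicator (fun _ => (1:ℝ)) p1 + (box x y).indicator (fun _ => (1:ℝ)) p2

/-- The squared L2 discrepancy of the two-point multiset `{p1, p2}`. -/
def L2sq (p1 p2 : ℝ × ℝ) : ℝ :=
  ∫ x in (0:ℝ)..1, ∫ y in (0:ℝ)..1, |countIn p1 p2 x y / 2 - x * y| ^ 2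

/-- The joint law of the jittered pair `(p1, p2)`: `p1` uniform on `Ω`,
`p2` uniform on `[0,1]² \ Ω`, independent. -/
def jitter (Ω : Set (ℝ × ℝ)) : Measure ((ℝ × ℝ) × (ℝ × ℝ)) :=
  (unif Ω).prod (unif (unitSq \ Ω))

/-- The expected squared L2 discrepancy of the two-point jittered sampling
construction associated to `Ω`. -/
def Djit (Ω : Set (ℝ × ℝ)) : ℝ := ∫ q, L2sq q.1 q.2 ∂(jitter Ω)

/-- `f1 Ω x y` is the Lebesgue measure of `Ω ∩ ([0,x] × [0,y])`. -/
def f1 (Ω : Set (ℝ × ℝ)) (x y : ℝ) : ℝ := (volume (Ω ∩ box x y)).toReal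

/-- The hypograph of `g` within the unit square. -/
def hypo (g : ℝ → ℝ) : Set (ℝ × ℝ) := {q ∈ unitSq | q.2 ≤ g q.1}

/-- `g` is an admissible partitioning function for area `p`: it is monotonically
decreasing on `[0,1]`, maps `[0,1]` into `[0,1]`, its hypograph has Lebesgue
measure `p`, and its hypograph is symmetric about the diagonal `y = x` up to a
Lebesgue-null set. -/
def Admissible (p : ℝ) (g : ℝ → ℝ) : Prop :=
  AntitoneOn g (Icc (0:ℝ) 1) ∧ (∀ x ∈ Icc (0:ℝ) 1, g x ∈ Icc (0:ℝ) 1) ∧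
  volume (hypo g) = ENNReal.ofReal p ∧
  (∀ᵐ q ∂(volume.restrict unitSq), (q ∈ hypo g ↔ q.swap ∈ hypo g))

end

theorem isClosed_box (x y : ℝ) : IsClosed (box x y) := isClosed_Icc.prod isClosed_Icc

theorem measurableSet_box (x y : ℝ) : MeasurableSet (box x y) := (isClosed_box x y).measurableSet

theorem measurableSet_unitSq : MeasurableSet unitSq := measurableSet_box 1 1

/-- The part of the unit square on or below the anti-diagonal. -/
def lowerTriangle : Set (ℝ × ℝ) := {q ∈ unitSq | q.1 + q.2 ≤ 1}

theorem measurableSet_lowerTriangle : MeasurableSet lowerTriangle :=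
  measurableSet_unitSq.inter (measurableSet_le (measurable_fst.add measurable_snd) measurable_const)

theorem box_subset_unitSq {x y : ℝ} (hx : x ≤ 1) (hy : y ≤ 1) : box x y ⊆ unitSq :=
  prod_mono (Icc_subset_Icc_right hx) (Icc_subset_Icc_right hy)

theorem volume_box {x y : ℝ} (hx : 0 ≤ x) : volume (box x y) = ENNReal.ofReal (x * y) := by
  rw [box, Measure.volume_eq_prod, Measure.prod_prod, Real.volume_Icc, Real.volume_Icc,
    ENNReal.ofReal_mul hx]
  simp

theorem volume_box_diff_lowerTriangle {x y : ℝ} (hx : x ≤ 1) (hy : y ≤ 1) :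
    volume (box x y \ lowerTriangle) = ENNReal.ofReal ((max (x + y - 1) 0) ^ 2 / 2) := by
  have hslice (a : ℝ) : volume (Prod.mk a ⁻¹' (box x y \ lowerTriangle)) =
      (Icc (1 - y) x).indicator (fun a => ENNReal.ofReal (a - (1 - y))) a := by
    by_cases ha : a ∈ Icc (1 - y) x
    · have : Prod.mk a ⁻¹' (box x y \ lowerTriangle) = Ioc (1 - a) y := by
        ext b
        simp only [box, lowerTriangle, unitSq, mem_preimage, mem_sdiff, mem_prod, mem_Icc,
          mem_ofPred_eq, mem_Ioc] at ha ⊢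
        grind
      rw [this, indicator_of_mem ha, Real.volume_Ioc]
      congr 1
      ring
    · have : Prod.mk a ⁻¹' (box x y \ lowerTriangle) = ∅ := by
        ext b
        simp only [box, lowerTriangle, unitSq, mem_preimage, mem_sdiff, mem_prod, mem_Icc,
          mem_ofPred_eq, mem_empty_iff_false] at ha ⊢
        grind
      rw [this, indicator_of_notMem ha, measure_empty]
  rw [Measure.volume_eq_prod, Measure.prod_apply
    ((measurableSet_box x y).diff measurableSet_lowerTriangle)]
  simp_rw [hslice]
  rw [lintegral_indicator measurableSet_Icc]
  rcases le_total x (1 - y) with h | h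
  · rw [max_eq_right (by linarith)]
    have : volume.restrict (Icc (1 - y) x) = 0 := by
      rw [Measure.restrict_eq_zero, Real.volume_Icc, ENNReal.ofReal_eq_zero]
      linarith
    simp [this]
  · rw [← ofReal_integral_eq_lintegral_ofReal, integral_Icc_eq_integral_Ioc,
      ← intervalIntegral.integral_of_le h, max_eq_left (by linarith)]
    · congr 1
      simp
      ring
    · exact (Continuous.continuousOn (by fun_prop)).integrableOn_Icc
    · filter_upwards [ae_restrict_mem measurableSet_Icc] with a ha
      simpa using ha.1

theorem volumeReal_box_diff_lowerTriangle {x y : ℝ} (hx : x ≤ 1) (hy : y ≤ 1) :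
    volume.real (box x y \ lowerTriangle) = (max (x + y - 1) 0) ^ 2 / 2 := by
  rw [Measure.real, volume_box_diff_lowerTriangle hx hy, ENNReal.toReal_ofReal (by positivity)]

theorem volumeReal_lowerTriangle_inter_box {x y : ℝ} (hx : x ∈ Icc (0 : ℝ) 1)
    (hy : y ∈ Icc (0 : ℝ) 1) :
    volume.real (box x y ∩ lowerTriangle) = x * y - (max (x + y - 1) 0) ^ 2 / 2 := by
  have h := measureReal_inter_add_sdiff (μ := volume) (s := box x y) measurableSet_lowerTriangle
    (by rw [volume_box hx.1]; exact ENNReal.ofReal_ne_top)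
  rw [volumeReal_box_diff_lowerTriangle hx.2 hy.2, Measure.real, Measure.real, volume_box hx.1,
    ENNReal.toReal_ofReal (mul_nonneg hx.1 hy.1)] at h
  rw [Measure.real]
  linarith

theorem volume_unitSq_diff_lowerTriangle :
    volume (unitSq \ lowerTriangle) = ENNReal.ofReal (1 / 2) := by
  rw [show unitSq = box 1 1 from rfl, volume_box_diff_lowerTriangle le_rfl le_rfl]
  norm_num

theorem volume_lowerTriangle : volume lowerTriangle = ENNReal.ofReal (1 / 2) := by
  have h := volumeReal_lowerTriangle_inter_box (x := 1) (y := 1) (by simp) (by simp)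
  rw [inter_eq_self_of_subset_right (show lowerTriangle ⊆ box 1 1 from sep_subset _ _)] at h
  have hfin : volume lowerTriangle ≠ ⊤ := by
    refine measure_ne_top_of_subset (show lowerTriangle ⊆ box 1 1 from sep_subset _ _) ?_
    rw [volume_box zero_le_one]
    exact ENNReal.ofReal_ne_top
  rw [← ENNReal.ofReal_toReal hfin, ← Measure.real, h]
  norm_num

theorem isProbabilityMeasure_unif {S : Set (ℝ × ℝ)} (h0 : volume S ≠ 0) (h1 : volume S ≠ ⊤) :
    IsProbabilityMeasure (unif S) :=
  ⟨by simp [unif, ENNReal.inv_mul_cancel h0 h1]⟩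

instance : IsProbabilityMeasure (unif lowerTriangle) :=
  isProbabilityMeasure_unif (by simp [volume_lowerTriangle]) (by simp [volume_lowerTriangle])

instance : IsProbabilityMeasure (unif (unitSq \ lowerTriangle)) :=
  isProbabilityMeasure_unif (by simp [volume_unitSq_diff_lowerTriangle])
    (by simp [volume_unitSq_diff_lowerTriangle])

theorem unif_lowerTriangle_real_box {x y : ℝ} (hx : x ∈ Icc (0 : ℝ) 1)
    (hy : y ∈ Icc (0 : ℝ) 1) :
    (unif lowerTriangle).real (box x y) = 2 * (x * y) - (max (x + y - 1) 0) ^ 2 := by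
  rw [unif, measureReal_ennreal_smul_apply, measureReal_restrict_apply (measurableSet_box x y),
    volumeReal_lowerTriangle_inter_box hx hy, volume_lowerTriangle, ENNReal.toReal_inv,
    ENNReal.toReal_ofReal (by norm_num)]
  ring

theorem unif_compl_lowerTriangle_real_box {x y : ℝ} (hx : x ≤ 1) (hy : y ≤ 1) :
    (unif (unitSq \ lowerTriangle)).real (box x y) = (max (x + y - 1) 0) ^ 2 := by
  rw [unif, measureReal_ennreal_smul_apply, measureReal_restrict_apply (measurableSet_box x y),
    ← inter_sdiff_assoc, inter_eq_self_of_subset_left (box_subset_unitSq hx hy),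
    volumeReal_box_diff_lowerTriangle hx hy, volume_unitSq_diff_lowerTriangle,
    ENNReal.toReal_inv, ENNReal.toReal_ofReal (by norm_num)]
  ring

theorem measurable_countIn :
    Measurable fun r : ((ℝ × ℝ) × (ℝ × ℝ)) × (ℝ × ℝ) => countIn r.1.1 r.1.2 r.2.1 r.2.2 := by
  have hS : MeasurableSet {r : (ℝ × ℝ) × (ℝ × ℝ) | r.1 ∈ box r.2.1 r.2.2} := by
    simp only [box, mem_prod, mem_Icc]
    measurability
  have h : Measurable fun r : (ℝ × ℝ) × (ℝ × ℝ) =>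
      (box r.2.1 r.2.2).indicator (fun _ => (1 : ℝ)) r.1 :=
    (measurable_const (a := (1 : ℝ))).indicator hS
  exact (h.comp (f := fun r : ((ℝ × ℝ) × (ℝ × ℝ)) × (ℝ × ℝ) => (r.1.1, r.2)) (by fun_prop)).add
    (h.comp (f := fun r : ((ℝ × ℝ) × (ℝ × ℝ)) × (ℝ × ℝ) => (r.1.2, r.2)) (by fun_prop))

theorem countIn_mem_Icc (p1 p2 : ℝ × ℝ) (x y : ℝ) : countIn p1 p2 x y ∈ Icc (0 : ℝ) 2 := by
  unfold countIn indicator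
  split_ifs <;> norm_num

theorem sq_discrepancy_le_one (p1 p2 : ℝ × ℝ) {x y : ℝ} (hx : x ∈ Ioc (0 : ℝ) 1)
    (hy : y ∈ Ioc (0 : ℝ) 1) : ‖|countIn p1 p2 x y / 2 - x * y| ^ 2‖ ≤ 1 := by
  obtain ⟨h0, h1⟩ := countIn_mem_Icc p1 p2 x y
  have hxy0 : 0 ≤ x * y := mul_nonneg hx.1.le hy.1.le
  have hxy1 : x * y ≤ 1 := mul_le_one₀ hx.2 hy.1.le hy.2
  rw [norm_pow, norm_abs_eq_norm, Real.norm_eq_abs]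
  exact pow_le_one₀ (abs_nonneg _) (abs_le.2 ⟨by linarith, by linarith⟩)

theorem integrable_sq_discrepancy (ρ : Measure ((ℝ × ℝ) × (ℝ × ℝ))) [IsFiniteMeasure ρ] :
    Integrable (fun r : ((ℝ × ℝ) × (ℝ × ℝ)) × (ℝ × ℝ) =>
        |countIn r.1.1 r.1.2 r.2.1 r.2.2 / 2 - r.2.1 * r.2.2| ^ 2)
      (ρ.prod ((volume.restrict (Ioc (0 : ℝ) 1)).prod (volume.restrict (Ioc (0 : ℝ) 1)))) := by
  refine Integrable.of_bound (C := 1) ?_ ?_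
  · simp_rw [sq_abs]
    exact (((measurable_countIn.div_const 2).sub (by fun_prop)).pow_const 2).aestronglyMeasurable
  · rw [Measure.prod_restrict]
    have := Measure.quasiMeasurePreserving_snd (μ := ρ)
      (ν := (volume.prod volume).restrict (Ioc (0 : ℝ) 1 ×ˢ Ioc (0 : ℝ) 1))
    filter_upwards [this.ae (ae_restrict_mem (measurableSet_Ioc.prod measurableSet_Ioc))]
      with r hr
    exact sq_discrepancy_le_one _ _ hr.1 hr.2

/-- The expectation of the squared discrepancy is the integral of the pointwise expectations. -/
theorem integral_L2sq (ρ : Measure ((ℝ × ℝ) × (ℝ × ℝ))) [IsFiniteMeasure ρ] :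
    ∫ q, L2sq q.1 q.2 ∂ρ = ∫ x in (0 : ℝ)..1, ∫ y in (0 : ℝ)..1,
      ∫ q, |countIn q.1 q.2 x y / 2 - x * y| ^ 2 ∂ρ := by
  have hint := integrable_sq_discrepancy ρ
  simp only [L2sq, intervalIntegral.integral_of_le zero_le_one]
  rw [← integral_prod (fun z : ℝ × ℝ => ∫ q, |countIn q.1 q.2 z.1 z.2 / 2 - z.1 * z.2| ^ 2 ∂ρ)
    hint.integral_prod_right]
  refine Eq.trans ?_ (integral_integral_swap hint)
  refine integral_congr_ae ?_
  filter_upwards [hint.prod_right_ae] with q hq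
  exact (integral_prod _ hq).symm

/-- The expected squared local discrepancy of two independent points, in terms of the
probabilities that they lie in the box. -/
theorem integral_sq_discrepancy_prod (μ ν : Measure (ℝ × ℝ)) [IsProbabilityMeasure μ]
    [IsProbabilityMeasure ν] (x y : ℝ) :
    ∫ q, |countIn q.1 q.2 x y / 2 - x * y| ^ 2 ∂(μ.prod ν) =
      (1 / 4 - x * y) * (μ.real (box x y) + ν.real (box x y)) +
        μ.real (box x y) * ν.real (box x y) / 2 + (x * y) ^ 2 := by
  set i : ℝ × ℝ → ℝ := (box x y).indicator fun _ => 1 with hi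
  have hiμ : Integrable i μ := (integrable_const 1).indicator (measurableSet_box x y)
  have hiν : Integrable i ν := (integrable_const 1).indicator (measurableSet_box x y)
  have hμ : ∫ q, i q ∂μ = μ.real (box x y) := integral_indicator_one (measurableSet_box x y)
  have hν : ∫ q, i q ∂ν = ν.real (box x y) := integral_indicator_one (measurableSet_box x y)
  have hsq (p : ℝ × ℝ) : i p ^ 2 = i p := by
    simp only [hi, indicator]
    split_ifs <;> norm_num
  have hexp (q : (ℝ × ℝ) × (ℝ × ℝ)) : |countIn q.1 q.2 x y / 2 - x * y| ^ 2 =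
      (1 / 4 - x * y) * (i q.1 + i q.2) + 1 / 2 * (i q.1 * i q.2) + (x * y) ^ 2 := by
    rw [sq_abs, countIn, ← hi]
    linear_combination (1 / 4) * hsq q.1 + (1 / 4) * hsq q.2
  have h1 : Integrable (fun q : (ℝ × ℝ) × (ℝ × ℝ) => i q.1) (μ.prod ν) := hiμ.comp_fst ν
  have h2 : Integrable (fun q : (ℝ × ℝ) × (ℝ × ℝ) => i q.2) (μ.prod ν) := hiν.comp_snd μ
  have h12 : Integrable (fun q : (ℝ × ℝ) × (ℝ × ℝ) => i q.1 * i q.2) (μ.prod ν) :=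
    hiμ.mul_prod hiν
  simp_rw [hexp]
  have hlin : Integrable (fun q : (ℝ × ℝ) × (ℝ × ℝ) => (1 / 4 - x * y) * (i q.1 + i q.2))
      (μ.prod ν) := (h1.add h2).const_mul _
  have hcross : Integrable (fun q : (ℝ × ℝ) × (ℝ × ℝ) => 1 / 2 * (i q.1 * i q.2))
      (μ.prod ν) := h12.const_mul _
  have hsum : Integrable (fun q : (ℝ × ℝ) × (ℝ × ℝ) =>
      (1 / 4 - x * y) * (i q.1 + i q.2) + 1 / 2 * (i q.1 * i q.2)) (μ.prod ν) := hlin.add hcross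
  rw [integral_add hsum (integrable_const _), integral_add hlin hcross,
    integral_const_mul,
    integral_const_mul, integral_add h1 h2, integral_prod_mul, integral_fun_fst, integral_fun_snd,
    hμ, hν]
  simp
  ring

theorem integral_expected_sq_discrepancy {x : ℝ} (hx : x ∈ Icc (0 : ℝ) 1) :
    ∫ y in (0 : ℝ)..1, (x * y / 2 - (x * y) ^ 2 + x * y * (max (x + y - 1) 0) ^ 2 -
        (max (x + y - 1) 0) ^ 4 / 2) =
      x / 4 - x ^ 2 / 3 + x ^ 4 / 3 - 11 * x ^ 5 / 60 := by
  have hx' : (0 : ℝ) ≤ 1 - x := by linarith [hx.2]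
  have hx'' : 1 - x ≤ 1 := by linarith [hx.1]
  rw [← intervalIntegral.integral_add_adjacent_intervals (b := 1 - x)
    (Continuous.intervalIntegrable (by fun_prop) _ _)
    (Continuous.intervalIntegrable (by fun_prop) _ _)]
  have e1 : ∫ y in (0 : ℝ)..(1 - x), (x * y / 2 - (x * y) ^ 2 +
      x * y * (max (x + y - 1) 0) ^ 2 - (max (x + y - 1) 0) ^ 4 / 2) =
      x * (1 - x) ^ 2 / 4 - x ^ 2 * (1 - x) ^ 3 / 3 := by
    rw [intervalIntegral.integral_congr (g := fun y => x * y / 2 - (x * y) ^ 2)]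
    · rw [intervalIntegral.integral_eq_sub_of_hasDerivAt
        (f := fun y => x * y ^ 2 / 4 - x ^ 2 * y ^ 3 / 3) (fun y _ => ?_)
        (Continuous.intervalIntegrable (by fun_prop) _ _)]
      · ring
      · refine HasDerivAt.congr_deriv (((((hasDerivAt_id' y).pow 2).const_mul x).div_const 4).sub
          ((((hasDerivAt_id' y).pow 3).const_mul (x ^ 2)).div_const 3)) ?_
        push_cast
        ring
    · intro y hy
      rw [uIcc_of_le hx'] at hy
      simp [max_eq_right (show x + y - 1 ≤ 0 by linarith [hy.2])]
  have e2 : ∫ y in (1 - x)..1, (x * y / 2 - (x * y) ^ 2 +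
      x * y * (max (x + y - 1) 0) ^ 2 - (max (x + y - 1) 0) ^ 4 / 2) =
      (x / 4 - x ^ 2 / 3) - (x * (1 - x) ^ 2 / 4 - x ^ 2 * (1 - x) ^ 3 / 3) +
        (x ^ 4 / 3 - 11 * x ^ 5 / 60) := by
    rw [intervalIntegral.integral_congr (g := fun y => x * y / 2 - (x * y) ^ 2 +
      x * y * (x + y - 1) ^ 2 - (x + y - 1) ^ 4 / 2)]
    · rw [intervalIntegral.integral_eq_sub_of_hasDerivAt
        (f := fun y => x * y ^ 2 / 4 - x ^ 2 * y ^ 3 / 3 + x * (x + y - 1) ^ 4 / 4 +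
          x * (1 - x) * (x + y - 1) ^ 3 / 3 - (x + y - 1) ^ 5 / 10) (fun y _ => ?_)
        (Continuous.intervalIntegrable (by fun_prop) _ _)]
      · ring
      · have hk : HasDerivAt (fun y : ℝ => x + y - 1) 1 y :=
          ((hasDerivAt_id' y).const_add x).sub_const 1
        refine HasDerivAt.congr_deriv ((((((((hasDerivAt_id' y).pow 2).const_mul x).div_const 4).sub
          ((((hasDerivAt_id' y).pow 3).const_mul (x ^ 2)).div_const 3)).add
          (((hk.pow 4).const_mul x).div_const 4)).add
          (((hk.pow 3).const_mul (x * (1 - x))).div_const 3)).sub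
          ((hk.pow 5).div_const 10)) ?_
        push_cast
        ring
    · intro y hy
      rw [uIcc_of_le hx''] at hy
      simp [max_eq_left (show 0 ≤ x + y - 1 by linarith [hy.1])]
  rw [e1, e2]
  ring

/-- For `Ω` the triangle below the anti-diagonal, the expected
squared L2-discrepancy of the two-point jittered construction is `1/20`. -/
theorem jitter_antidiagonal_triangle :
    Djit {q ∈ unitSq | q.1 + q.2 ≤ 1} = 1/20 := by
  have hmean {x y : ℝ} (hx : x ∈ Icc (0 : ℝ) 1) (hy : y ∈ Icc (0 : ℝ) 1) :
      ∫ q, |countIn q.1 q.2 x y / 2 - x * y| ^ 2 ∂(jitter lowerTriangle) =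
        x * y / 2 - (x * y) ^ 2 + x * y * (max (x + y - 1) 0) ^ 2 -
          (max (x + y - 1) 0) ^ 4 / 2 := by
    rw [jitter, integral_sq_discrepancy_prod, unif_lowerTriangle_real_box hx hy,
      unif_compl_lowerTriangle_real_box hx.2 hy.2]
    ring
  change ∫ q, L2sq q.1 q.2 ∂((unif lowerTriangle).prod (unif (unitSq \ lowerTriangle))) = 1 / 20
  rw [integral_L2sq, intervalIntegral.integral_congr
    (g := fun x => x / 4 - x ^ 2 / 3 + x ^ 4 / 3 - 11 * x ^ 5 / 60)]
  · rw [intervalIntegral.integral_eq_sub_of_hasDerivAt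
      (f := fun x => x ^ 2 / 8 - x ^ 3 / 9 + x ^ 5 / 15 - 11 * x ^ 6 / 360) (fun x _ => ?_)
      (Continuous.intervalIntegrable (by fun_prop) _ _)]
    · norm_num
    · refine HasDerivAt.congr_deriv ((((((hasDerivAt_id' x).pow 2).div_const 8).sub
        (((hasDerivAt_id' x).pow 3).div_const 9)).add
        (((hasDerivAt_id' x).pow 5).div_const 15)).sub
        ((((hasDerivAt_id' x).pow 6).const_mul 11).div_const 360)) ?_
      push_cast
      ring
  · intro x hx
    rw [uIcc_of_le zero_le_one] at hx
    simp only
    rw [← integral_expected_sq_discrepancy hx]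
    refine intervalIntegral.integral_congr fun y hy => ?_
    rw [uIcc_of_le zero_le_one] at hy
    exact hmean hx hy
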